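/- (Pointwise content of Proposition 4.2.) Let (𝓕, 𝓙) be a generalized almost para-Hermitian structure on a finite-dimensional real vector space V, with 𝓗 = 𝓙∘𝓕 and associated triple (γ₀, ψ, F). Let W ⊆ V be a subspace, B = W ⊕ V* ⊆ V ⊕ V*, and ann W = { α ∈ V* : α|_W = 0 }. Then W is regular invariant (i.e., γ₀|_W is nondegenerate and F(W^ℂ) ⊆ W^ℂ) if and only if both of the following hold: (i) 𝓕 induces a generalized almost para-complex structure and 𝓙 induces a generalized almost complex structure on W ⊕ W* via the pullback operation ι*U = { (X, η∘ι) : X ∈ W, (X, η) ∈ U } applied to their eigenspaces, and (ii) B = (B ∩ 𝓕(B) ∩ 𝓙(B) ∩ 𝓗(B)) + (0 ⊕ ann W). -/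

import Mathlib

noncomputable section

open TensorProduct

attribute [local instance 3000] TensorProduct.addCommMonoid TensorProduct.leftModule

/-- The "big tangent space" `V ⊕ V*`. -/
abbrev Big (V : Type) [AddCommGroup V] [Module ℝ V] : Type := V × Module.Dual ℝ V

variable (V : Type) [AddCommGroup V] [Module ℝ V]

/-- The pairing metric `g((X,α),(Y,β)) = (α Y + β X)/2` on `V ⊕ V*`. -/
def gP : Big V →ₗ[ℝ] Big V →ₗ[ℝ] ℝ :=
  LinearMap.mk₂ ℝ (fun u v => (u.2 v.1 + v.2 u.1) / 2)
    (fun m₁ m₂ n => by simp; ring)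
    (fun c m n => by simp; ring)
    (fun m n₁ n₂ => by simp; ring)
    (fun c m n => by simp; ring)

/-- A generalized almost para-complex structure on `V`. -/
def IsGenParaCx (F : Big V →ₗ[ℝ] Big V) : Prop :=
  F ∘ₗ F = LinearMap.id ∧ ∀ u v, gP V (F u) v = - gP V u (F v)

/-- A generalized almost complex structure on `V`. -/
def IsGenCx (J : Big V →ₗ[ℝ] Big V) : Prop :=
  J ∘ₗ J = - LinearMap.id ∧ ∀ u v, gP V (J u) v = - gP V u (J v)

/-- The bilinear form `γ(α,β) = -2 g(𝓕(0,α), 𝓙(0,β))` on `V*`. -/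
def gammaOf (F J : Big V →ₗ[ℝ] Big V) (α β : Module.Dual ℝ V) : ℝ :=
  -2 * gP V (F (0, α)) (J (0, β))

/-- A generalized almost para-Hermitian structure on `V`: a commuting pair of a
generalized almost para-complex structure and a generalized almost complex structure
whose associated bilinear form `γ` on `V*` is nondegenerate. -/
def IsGAPH (F J : Big V →ₗ[ℝ] Big V) : Prop :=
  IsGenParaCx V F ∧ IsGenCx V J ∧ F ∘ₗ J = J ∘ₗ F ∧
    ∀ α, (∀ β, gammaOf V F J α β = 0) → α = 0

/-- Complexification of `V`. -/
abbrev Vc : Type := ℂ ⊗[ℝ] V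

/-- Complexification of the big space `V ⊕ V*`. -/
abbrev Bc : Type := ℂ ⊗[ℝ] Big V

/-- The projection `(V ⊕ V*)^ℂ → V^ℂ`. -/
def prV : Bc V →ₗ[ℂ] Vc V := LinearMap.baseChange ℂ (LinearMap.fst ℝ V (Module.Dual ℝ V))

/-- The inclusion `V^ℂ → (V ⊕ V*)^ℂ`, `X ↦ (X, 0)`. -/
def inV : Vc V →ₗ[ℂ] Bc V := LinearMap.baseChange ℂ (LinearMap.inl ℝ V (Module.Dual ℝ V))

/-- The complexified pairing metric on `(V ⊕ V*)^ℂ`. -/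
def gc : Bc V →ₗ[ℂ] Bc V →ₗ[ℂ] ℂ := LinearMap.BilinForm.baseChange ℂ (gP V)

/-- Complex-bilinear extension of a bilinear form on `V` to `V^ℂ`. -/
def bcB (B : LinearMap.BilinForm ℝ V) : Vc V →ₗ[ℂ] Vc V →ₗ[ℂ] ℂ :=
  LinearMap.BilinForm.baseChange ℂ B

/-- The `μ`-eigenspace of an endomorphism of `(V ⊕ V*)^ℂ`. -/
def eigSp (T : Bc V →ₗ[ℂ] Bc V) (μ : ℂ) : Submodule ℂ (Bc V) where
  carrier := {u | T u = μ • u}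
  add_mem' := by
    intro a b ha hb
    simp only [Set.mem_setOf_eq, map_add] at *
    rw [ha, hb, smul_add]
  zero_mem' := by simp
  smul_mem' := by
    intro c u hu
    simp only [Set.mem_setOf_eq, map_smul] at *
    rw [hu, smul_comm]

/-- The `i`-eigenspace of the complexification of an endomorphism of `V ⊕ V*`. -/
def Hsp (H : Big V →ₗ[ℝ] Big V) : Submodule ℂ (Bc V) :=
  eigSp V (LinearMap.baseChange ℂ H) Complex.I

/-- The `+1`-eigenspace of the complexification of an endomorphism of `V ⊕ V*`. -/
def Fplus (F : Big V →ₗ[ℝ] Big V) : Submodule ℂ (Bc V) :=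
  eigSp V (LinearMap.baseChange ℂ F) 1

/-- The `-1`-eigenspace of the complexification of an endomorphism of `V ⊕ V*`. -/
def Fminus (F : Big V →ₗ[ℝ] Big V) : Submodule ℂ (Bc V) :=
  eigSp V (LinearMap.baseChange ℂ F) (-1)

/-- The graph `{(X, ψ^ℂ(X,·) + i γ₀^ℂ(X,·)) : X ∈ V^ℂ}` inside `(V ⊕ V*)^ℂ`.
An element `u = (X, α)` lies on the graph iff `α(Y) = ψ^ℂ(X,Y) + i γ₀^ℂ(X,Y)` for all
`Y ∈ V^ℂ`; the value `α(Y)` is expressed canonically as `2 g^ℂ(u, (Y,0))`. -/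
def graphSet (γ₀ ψ : LinearMap.BilinForm ℝ V) : Set (Bc V) :=
  {u | ∀ Y : Vc V, 2 * gc V u (inV V Y) =
      bcB V ψ (prV V u) Y + Complex.I * bcB V γ₀ (prV V u) Y}

/-- Complex conjugation of `(V ⊕ V*)^ℂ` with respect to the real form `V ⊕ V*`. -/
def conjMap : Bc V →ₗ[ℝ] Bc V := LinearMap.rTensor (Big V) Complex.conjAe.toLinearMap

/-- The complex conjugate of a complex subspace of `(V ⊕ V*)^ℂ` (the image of the
subspace under conjugation; taking the `ℂ`-span does not enlarge the image, since the
image of a complex subspace under conjugation is again a complex subspace). -/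
def conjSub (S : Submodule ℂ (Bc V)) : Submodule ℂ (Bc V) :=
  Submodule.span ℂ (conjMap V '' (S : Set (Bc V)))

noncomputable instance (S : Submodule ℂ (Bc V)) : AddCommGroup ↥S :=
  Module.addCommMonoidToAddCommGroup ℂ

/-- A `g`-isotropic subspace of `(V ⊕ V*)^ℂ`. -/
def IsIsotropic (S : Submodule ℂ (Bc V)) : Prop := ∀ u ∈ S, ∀ v ∈ S, gc V u v = 0

/-- A maximal `g`-isotropic subspace of `(V ⊕ V*)^ℂ`: a `g`-isotropic subspace of
complex dimension `dim V`. -/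
def MaxIsotropic (S : Submodule ℂ (Bc V)) : Prop :=
  IsIsotropic V S ∧ Module.finrank ℂ S = Module.finrank ℝ V

/-- The endomorphism of `V^ℂ` induced by an endomorphism `A` of `V ⊕ V*` via `τ`:
`X ↦ pr_{V^ℂ} (A^ℂ (τ X))`. -/
def Fop (A : Big V →ₗ[ℝ] Big V) (τ : Vc V →ₗ[ℂ] Bc V) : Vc V → Vc V :=
  fun X => prV V (LinearMap.baseChange ℂ A (τ X))

/-- The canonical (real) inclusion `V → V^ℂ`. -/
def realIncl : V →ₗ[ℝ] Vc V := TensorProduct.mk ℝ ℂ V 1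

/-- The canonical (real) inclusion `V ⊕ V* → (V ⊕ V*)^ℂ`. -/
def realInclB : Big V →ₗ[ℝ] Bc V := TensorProduct.mk ℝ ℂ (Big V) 1

/-- The B-field transformation `(X, α) ↦ (X, α + B(X,·))` of `V ⊕ V*`. -/
def Bfield (B : LinearMap.BilinForm ℝ V) : Big V →ₗ[ℝ] Big V :=
  LinearMap.prod (LinearMap.fst ℝ V (Module.Dual ℝ V))
    (LinearMap.snd ℝ V (Module.Dual ℝ V) + B ∘ₗ LinearMap.fst ℝ V (Module.Dual ℝ V))

/-- `(X, α) ↦ (F X, -α ∘ F)`. -/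
def genF (F : V →ₗ[ℝ] V) : Big V →ₗ[ℝ] Big V := F.prodMap (- F.dualMap)

/-- `(X, α) ↦ (♯ α, -γ₀(X,·))`. -/
def genH (γ₀ : LinearMap.BilinForm ℝ V) (sharp : Module.Dual ℝ V →ₗ[ℝ] V) :
    Big V →ₗ[ℝ] Big V :=
  LinearMap.prod (sharp ∘ₗ LinearMap.snd ℝ V (Module.Dual ℝ V))
    (- (γ₀ ∘ₗ LinearMap.fst ℝ V (Module.Dual ℝ V)))

/-- The projection `(1/4)(Id + 𝓕^ℂ) ∘ (Id - i 𝓗^ℂ)` onto `𝐇₊`, as a function. -/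
def prHplus (F H : Big V →ₗ[ℝ] Big V) (u : Bc V) : Bc V :=
  ((1 : ℂ)/4) • ((u - Complex.I • LinearMap.baseChange ℂ H u) +
    LinearMap.baseChange ℂ F (u - Complex.I • LinearMap.baseChange ℂ H u))

/-- The projection `(1/4)(Id - 𝓕^ℂ) ∘ (Id - i 𝓗^ℂ)` onto `𝐇₋`, as a function. -/
def prHminus (F H : Big V →ₗ[ℝ] Big V) (u : Bc V) : Bc V :=
  ((1 : ℂ)/4) • ((u - Complex.I • LinearMap.baseChange ℂ H u) -
    LinearMap.baseChange ℂ F (u - Complex.I • LinearMap.baseChange ℂ H u))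

/-- The inclusion `W ⊕ V* → V ⊕ V*` over a subspace `W ⊆ V`. -/
def bigIncl (W : Submodule ℝ V) : (↥W × Module.Dual ℝ V) →ₗ[ℝ] Big V :=
  (W.subtype).prodMap LinearMap.id

/-- The restriction `W ⊕ V* → W ⊕ W*`, restricting functionals to `W`. -/
def bigRes (W : Submodule ℝ V) : (↥W × Module.Dual ℝ V) →ₗ[ℝ] Big ↥W :=
  LinearMap.prodMap LinearMap.id (W.subtype.dualMap)

/-- The pullback `ι*U = {(X, η∘ι) : X ∈ W^ℂ, (X, η) ∈ U}` of a subspace of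
`(V ⊕ V*)^ℂ` to `(W ⊕ W*)^ℂ`. -/
def pullback (W : Submodule ℝ V) (U : Submodule ℂ (Bc V)) : Submodule ℂ (Bc ↥W) :=
  Submodule.map (LinearMap.baseChange ℂ (bigRes V W))
    (Submodule.comap (LinearMap.baseChange ℂ (bigIncl V W)) U)

/-- Restriction of a bilinear form on `V` to a subspace `W`. -/
def resB (W : Submodule ℝ V) (B : LinearMap.BilinForm ℝ V) : LinearMap.BilinForm ℝ ↥W :=
  B.compl₁₂ W.subtype W.subtype

section AbstractLinearAlgebra

open Module

/-- A nondegenerate form pairs two complementary isotropic subspaces perfectly, so the dimension of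
one is bounded by that of the other. -/
theorem finrank_le_of_isCompl_isotropic {E : Type*} [AddCommGroup E] [Module ℂ E]
    [FiniteDimensional ℂ E] (g : E →ₗ[ℂ] E →ₗ[ℂ] ℂ) (hg : ∀ u, (∀ v, g u v = 0) → u = 0)
    {P Q : Submodule ℂ E} (hPQ : IsCompl P Q) (hQ : ∀ u ∈ Q, ∀ v ∈ Q, g u v = 0) :
    finrank ℂ Q ≤ finrank ℂ P := by
  rw [← Subspace.dual_finrank_eq (K := ℂ) (V := P)]
  refine LinearMap.finrank_le_finrank_of_injective (f := (g.compl₁₂ Q.subtype P.subtype)) ?_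
  rw [injective_iff_map_eq_zero]
  intro q hq
  refine Subtype.ext (hg _ fun v => ?_)
  obtain ⟨p, hp, q', hq', rfl⟩ :=
    Submodule.mem_sup.1 (hPQ.sup_eq_top ▸ Submodule.mem_top : v ∈ P ⊔ Q)
  rw [map_add, hQ _ q.2 _ hq', add_zero]
  exact LinearMap.congr_fun hq ⟨p, hp⟩

theorem finrank_eq_of_isCompl_isotropic {E : Type*} [AddCommGroup E] [Module ℂ E]
    [FiniteDimensional ℂ E] (g : E →ₗ[ℂ] E →ₗ[ℂ] ℂ) (hg : ∀ u, (∀ v, g u v = 0) → u = 0)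
    {P Q : Submodule ℂ E} (hPQ : IsCompl P Q) (hP : ∀ u ∈ P, ∀ v ∈ P, g u v = 0)
    (hQ : ∀ u ∈ Q, ∀ v ∈ Q, g u v = 0) {n : ℕ} (hn : finrank ℂ E = 2 * n) :
    finrank ℂ P = n ∧ finrank ℂ Q = n := by
  have h1 := finrank_le_of_isCompl_isotropic g hg hPQ hQ
  have h2 := finrank_le_of_isCompl_isotropic g hg hPQ.symm hP
  have h3 := Submodule.finrank_add_eq_of_isCompl hPQ
  omega

end AbstractLinearAlgebra

section Complexification

variable {M N : Type} [AddCommGroup M] [Module ℝ M] [AddCommGroup N] [Module ℝ N]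

theorem one_tmul_add_I_tmul_inj {a b c d : M}
    (h : (1 : ℂ) ⊗ₜ[ℝ] a + Complex.I ⊗ₜ[ℝ] b = (1 : ℂ) ⊗ₜ[ℝ] c + Complex.I ⊗ₜ[ℝ] d) :
    a = c ∧ b = d := by
  have key (f : ℂ →ₗ[ℝ] ℝ) := congrArg
    ((TensorProduct.lid ℝ M).toLinearMap ∘ₗ LinearMap.rTensor M f) h
  exact ⟨by simpa using key Complex.reLm, by simpa using key Complex.imLm⟩

theorem exists_one_tmul_add_I_tmul (u : ℂ ⊗[ℝ] M) :
    ∃ a b : M, u = (1 : ℂ) ⊗ₜ[ℝ] a + Complex.I ⊗ₜ[ℝ] b := by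
  induction u with
  | zero => exact ⟨0, 0, by simp⟩
  | tmul z m =>
    refine ⟨z.re • m, z.im • m, ?_⟩
    rw [TensorProduct.tmul_smul, TensorProduct.tmul_smul, TensorProduct.smul_tmul',
      TensorProduct.smul_tmul', ← TensorProduct.add_tmul]
    congr 1
    simp [Complex.re_add_im]
  | add u v hu hv =>
    obtain ⟨a, b, rfl⟩ := hu
    obtain ⟨c, d, rfl⟩ := hv
    exact ⟨a + c, b + d, by simp only [TensorProduct.tmul_add]; abel⟩

theorem baseChange_comp_apply {P : Type} [AddCommGroup P] [Module ℝ P] (f : N →ₗ[ℝ] P)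
    (e : M →ₗ[ℝ] N) (u : ℂ ⊗[ℝ] M) :
    LinearMap.baseChange ℂ f (LinearMap.baseChange ℂ e u) = LinearMap.baseChange ℂ (f ∘ₗ e) u := by
  rw [LinearMap.baseChange_comp]; rfl

end Complexification

section BigSpace

variable {V : Type} [AddCommGroup V] [Module ℝ V]

theorem mem_eigSp {T : Bc V →ₗ[ℂ] Bc V} {μ : ℂ} {u : Bc V} : u ∈ eigSp V T μ ↔ T u = μ • u :=
  Iff.rfl

theorem gP_apply (u v : Big V) : gP V u v = (u.2 v.1 + v.2 u.1) / 2 := rfl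

theorem gc_tmul (a b : ℂ) (u v : Big V) : gc V (a ⊗ₜ u) (b ⊗ₜ v) = a * b * (gP V u v : ℂ) := by
  simp [gc, LinearMap.BilinForm.baseChange_tmul, mul_comm]

theorem bcB_tmul (B : LinearMap.BilinForm ℝ V) (a b : ℂ) (u v : V) :
    bcB V B (a ⊗ₜ u) (b ⊗ₜ v) = a * b * (B u v : ℂ) := by
  simp [bcB, LinearMap.BilinForm.baseChange_tmul, mul_comm]

theorem gP_nondegenerate {u : Big V} (hu : ∀ v, gP V u v = 0) : u = 0 := by
  obtain ⟨x, α⟩ := u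
  have hα : α = 0 := by
    ext y
    simpa [gP_apply] using hu (y, 0)
  have hx : x = 0 := by
    rw [← Module.forall_dual_apply_eq_zero_iff ℝ]
    intro β
    simpa [gP_apply] using hu (0, β)
  simp [hα, hx]

theorem gc_nondegenerate {u : Bc V} (hu : ∀ v, gc V u v = 0) : u = 0 := by
  obtain ⟨a, b, hab⟩ := exists_one_tmul_add_I_tmul u
  have key (v : Big V) : gP V a v = 0 ∧ gP V b v = 0 := by
    have := hu ((1 : ℂ) ⊗ₜ v)
    rw [hab, map_add, LinearMap.add_apply, gc_tmul, gc_tmul] at this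
    exact ⟨by simpa using congrArg Complex.re this, by simpa using congrArg Complex.im this⟩
  rw [hab, gP_nondegenerate fun v => (key v).1, gP_nondegenerate fun v => (key v).2]
  simp

/-- An identity between the pullbacks of two pairing metrics passes to the complexifications. -/
theorem gc_baseChange {M N : Type} [AddCommGroup M] [Module ℝ M] [AddCommGroup N] [Module ℝ N]
    {V' : Type} [AddCommGroup V'] [Module ℝ V']
    (f : M →ₗ[ℝ] Big V) (e : N →ₗ[ℝ] Big V) (f' : M →ₗ[ℝ] Big V') (e' : N →ₗ[ℝ] Big V')
    (h : ∀ m n, gP V (f m) (e n) = gP V' (f' m) (e' n)) (u : ℂ ⊗[ℝ] M) (v : ℂ ⊗[ℝ] N) :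
    gc V (LinearMap.baseChange ℂ f u) (LinearMap.baseChange ℂ e v) =
      gc V' (LinearMap.baseChange ℂ f' u) (LinearMap.baseChange ℂ e' v) := by
  induction u with
  | zero => simp
  | add u₁ u₂ h₁ h₂ => simp only [map_add, LinearMap.add_apply, h₁, h₂]
  | tmul a m =>
    induction v with
    | zero => simp
    | add u₁ u₂ h₁ h₂ => simp only [map_add, h₁, h₂]
    | tmul b n => simp only [LinearMap.baseChange_tmul, gc_tmul, h]

theorem gc_baseChange_skew {A : Big V →ₗ[ℝ] Big V} (hA : ∀ u v, gP V (A u) v = - gP V u (A v))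
    (u v : Bc V) : gc V (LinearMap.baseChange ℂ A u) v = - gc V u (LinearMap.baseChange ℂ A v) := by
  have := gc_baseChange A LinearMap.id LinearMap.id (-A)
    (fun m n => by simp [hA]) u v
  simpa [LinearMap.baseChange_neg] using this

theorem isIsotropic_eigSp {A : Big V →ₗ[ℝ] Big V} (hA : ∀ u v, gP V (A u) v = - gP V u (A v))
    {μ : ℂ} (hμ : μ ≠ 0) : IsIsotropic V (eigSp V (LinearMap.baseChange ℂ A) μ) := by
  intro u hu v hv
  have := gc_baseChange_skew hA u v
  rw [mem_eigSp.1 hu, mem_eigSp.1 hv] at this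
  simp only [map_smul, LinearMap.smul_apply, smul_eq_mul] at this
  have h2 : μ * (2 * gc V u v) = 0 := by linear_combination this
  simpa [hμ] using h2

theorem isCompl_eigSp {A : Big V →ₗ[ℝ] Big V} {μ : ℂ} (hμ : μ ≠ 0)
    (hA : ∀ u, LinearMap.baseChange ℂ A (LinearMap.baseChange ℂ A u) = (μ * μ) • u) :
    IsCompl (eigSp V (LinearMap.baseChange ℂ A) μ) (eigSp V (LinearMap.baseChange ℂ A) (-μ)) := by
  constructor
  · rw [Submodule.disjoint_def]
    intro u h₁ h₂
    have h3 : (2 * μ) • u = 0 := by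
      have := (mem_eigSp.1 h₁).symm.trans (mem_eigSp.1 h₂)
      rw [mul_smul, two_smul]
      nth_rewrite 1 [this]
      simp
    exact (smul_eq_zero.1 h3).resolve_left (by simp [hμ])
  · rw [codisjoint_iff, eq_top_iff]
    intro u _
    rw [Submodule.mem_sup]
    refine ⟨(2 * μ)⁻¹ • (μ • u + LinearMap.baseChange ℂ A u), ?_,
      (2 * μ)⁻¹ • (μ • u - LinearMap.baseChange ℂ A u), ?_, ?_⟩
    · rw [mem_eigSp, map_smul, map_add, map_smul, hA]; module
    · rw [mem_eigSp, map_smul, map_sub, map_smul, hA]; module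
    · rw [← smul_add, add_add_sub_cancel, ← two_smul ℂ (μ • u), smul_smul, smul_smul,
        mul_assoc, inv_mul_cancel₀ (by simp [hμ]), one_smul]

theorem maxIsotropic_eigSp [FiniteDimensional ℝ V] {A : Big V →ₗ[ℝ] Big V}
    (hskew : ∀ u v, gP V (A u) v = - gP V u (A v)) {μ : ℂ} (hμ : μ ≠ 0)
    (hA : ∀ u, LinearMap.baseChange ℂ A (LinearMap.baseChange ℂ A u) = (μ * μ) • u) :
    MaxIsotropic V (eigSp V (LinearMap.baseChange ℂ A) μ) := by
  refine ⟨isIsotropic_eigSp hskew hμ, ?_⟩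
  refine (finrank_eq_of_isCompl_isotropic (gc V) (fun u => gc_nondegenerate)
    (isCompl_eigSp hμ hA) (isIsotropic_eigSp hskew hμ)
    (isIsotropic_eigSp hskew (neg_ne_zero.2 hμ)) ?_).1
  rw [Module.finrank_baseChange, Module.finrank_prod, Subspace.dual_finrank_eq, two_mul]

theorem conjMap_tmul (z : ℂ) (u : Big V) :
    conjMap V (z ⊗ₜ u) = (starRingEnd ℂ z) ⊗ₜ u := rfl

theorem conjMap_conjMap (u : Bc V) : conjMap V (conjMap V u) = u := by
  induction u using TensorProduct.induction_on with
  | zero => simp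
  | add u₁ u₂ h₁ h₂ => simp only [map_add, h₁, h₂]
  | tmul a m => simp [conjMap_tmul]

theorem conjMap_smul (c : ℂ) (u : Bc V) :
    conjMap V (c • u) = (starRingEnd ℂ c) • conjMap V u := by
  induction u using TensorProduct.induction_on with
  | zero => simp
  | add u₁ u₂ h₁ h₂ => simp only [map_add, smul_add, h₁, h₂]
  | tmul a m => simp [conjMap_tmul, TensorProduct.smul_tmul']

theorem conjMap_baseChange (A : Big V →ₗ[ℝ] Big V) (u : Bc V) :
    conjMap V (LinearMap.baseChange ℂ A u) = LinearMap.baseChange ℂ A (conjMap V u) := by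
  induction u using TensorProduct.induction_on with
  | zero => simp
  | add u₁ u₂ h₁ h₂ => simp only [map_add, h₁, h₂]
  | tmul a m => simp [conjMap_tmul]

theorem conjSub_eigSp (A : Big V →ₗ[ℝ] Big V) (μ : ℂ) :
    conjSub V (eigSp V (LinearMap.baseChange ℂ A) μ) =
      eigSp V (LinearMap.baseChange ℂ A) (starRingEnd ℂ μ) := by
  have key {ν : ℂ} {u : Bc V} (hu : u ∈ eigSp V (LinearMap.baseChange ℂ A) ν) :
      conjMap V u ∈ eigSp V (LinearMap.baseChange ℂ A) (starRingEnd ℂ ν) := by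
    rw [mem_eigSp, ← conjMap_baseChange, mem_eigSp.1 hu, conjMap_smul]
  refine le_antisymm (Submodule.span_le.2 ?_) fun u hu => Submodule.subset_span ?_
  · rintro _ ⟨u, hu, rfl⟩
    exact key hu
  · exact ⟨conjMap V u, by simpa using key hu, conjMap_conjMap u⟩

end BigSpace

section InducedStructure

variable {V : Type} [AddCommGroup V] [Module ℝ V] {W : Submodule ℝ V}

theorem gP_bigIncl (p q : ↥W × Module.Dual ℝ V) :
    gP V (bigIncl V W p) (bigIncl V W q) = gP ↥W (bigRes V W p) (bigRes V W q) := rfl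

theorem exists_induced_endomorphism {M N : Type} [AddCommGroup M] [Module ℝ M] [AddCommGroup N]
    [Module ℝ N] {T : M →ₗ[ℝ] N} (hT : Function.Injective T) {A : N →ₗ[ℝ] N}
    (h : ∀ m, ∃ m', T m' = A (T m)) : ∃ A' : M →ₗ[ℝ] M, ∀ m, T (A' m) = A (T m) := by
  obtain ⟨L, hL⟩ := T.exists_leftInverse_of_injective (LinearMap.ker_eq_bot.2 hT)
  refine ⟨L ∘ₗ A ∘ₗ T, fun m => ?_⟩
  obtain ⟨m', hm'⟩ := h m
  rw [LinearMap.comp_apply, LinearMap.comp_apply, ← hm', ← LinearMap.comp_apply L, hL,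
    LinearMap.id_apply]

/-- If `W ⊕ W*` embeds isometrically in `V ⊕ V*` as an `A`-stable subspace of `W ⊕ V*`, by a section
of the restriction map, then the pullbacks of the eigenspaces of `A` are the eigenspaces of the
induced endomorphism. -/
theorem pullback_eigSp {t : Big ↥W →ₗ[ℝ] (↥W × Module.Dual ℝ V)}
    (ht : ∀ w, bigRes V W (t w) = w) {A : Big V →ₗ[ℝ] Big V} {A' : Big ↥W →ₗ[ℝ] Big ↥W}
    (hA : ∀ u v, gP V (A u) v = - gP V u (A v))
    (hA' : ∀ u v, gP ↥W (A' u) v = - gP ↥W u (A' v))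
    (hAA' : ∀ w, bigIncl V W (t (A' w)) = A (bigIncl V W (t w))) (μ : ℂ) :
    pullback V W (eigSp V (LinearMap.baseChange ℂ A) μ) =
      eigSp ↥W (LinearMap.baseChange ℂ A') μ := by
  have hint (w : Bc ↥W) : LinearMap.baseChange ℂ (bigIncl V W)
      (LinearMap.baseChange ℂ t (LinearMap.baseChange ℂ A' w)) = LinearMap.baseChange ℂ A
      (LinearMap.baseChange ℂ (bigIncl V W) (LinearMap.baseChange ℂ t w)) := by
    simp only [baseChange_comp_apply]
    congr 2
    exact LinearMap.ext hAA'
  have hres (w : Bc ↥W) : LinearMap.baseChange ℂ (bigRes V W) (LinearMap.baseChange ℂ t w) = w := by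
    rw [baseChange_comp_apply, show bigRes V W ∘ₗ t = LinearMap.id from LinearMap.ext ht,
      LinearMap.baseChange_id, LinearMap.id_apply]
  have hg (p : ℂ ⊗[ℝ] (↥W × Module.Dual ℝ V)) (w : Bc ↥W) :
      gc ↥W (LinearMap.baseChange ℂ (bigRes V W) p) w =
        gc V (LinearMap.baseChange ℂ (bigIncl V W) p)
          (LinearMap.baseChange ℂ (bigIncl V W) (LinearMap.baseChange ℂ t w)) := by
    conv_lhs => rw [← hres w]
    exact gc_baseChange _ _ _ _ (fun p q => (gP_bigIncl p q).symm) _ _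
  apply le_antisymm
  · rintro _ ⟨p, hp, rfl⟩
    have hp : LinearMap.baseChange ℂ A (LinearMap.baseChange ℂ (bigIncl V W) p) =
      μ • LinearMap.baseChange ℂ (bigIncl V W) p := hp
    rw [mem_eigSp, ← sub_eq_zero]
    refine gc_nondegenerate fun w => ?_
    rw [map_sub, LinearMap.sub_apply, gc_baseChange_skew hA', hg, hint, ← gc_baseChange_skew hA, hp,
      map_smul, map_smul, LinearMap.smul_apply, LinearMap.smul_apply, hg, sub_self]
  · intro w hw
    refine ⟨LinearMap.baseChange ℂ t w, ?_, hres w⟩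
    change LinearMap.baseChange ℂ A _ = μ • _
    rw [← hint, mem_eigSp.1 hw, map_smul, map_smul]

theorem exists_pullback_eigSp {t : Big ↥W →ₗ[ℝ] (↥W × Module.Dual ℝ V)}
    (ht : ∀ w, bigRes V W (t w) = w) {A : Big V →ₗ[ℝ] Big V}
    (hA : ∀ u v, gP V (A u) v = - gP V u (A v)) {c : ℝ} (hc : ∀ u, A (A u) = c • u)
    (hstable : ∀ w, ∃ w', bigIncl V W (t w') = A (bigIncl V W (t w))) :
    ∃ A' : Big ↥W →ₗ[ℝ] Big ↥W, (∀ u v, gP ↥W (A' u) v = - gP ↥W u (A' v)) ∧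
      (∀ u, LinearMap.baseChange ℂ A' (LinearMap.baseChange ℂ A' u) = (c : ℂ) • u) ∧
      ∀ μ, pullback V W (eigSp V (LinearMap.baseChange ℂ A) μ) =
        eigSp ↥W (LinearMap.baseChange ℂ A') μ := by
  have hinj : Function.Injective (bigIncl V W ∘ₗ t) := by
    have hi : Function.Injective (bigIncl V W) := fun p q hpq =>
      Prod.ext (Subtype.ext (Prod.ext_iff.1 hpq).1) (Prod.ext_iff.1 hpq).2
    exact hi.comp (Function.LeftInverse.injective ht)
  obtain ⟨A', hA'⟩ := exists_induced_endomorphism hinj hstable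
  have hg (u v : Big ↥W) : gP ↥W u v = gP V (bigIncl V W (t u)) (bigIncl V W (t v)) := by
    rw [gP_bigIncl, ht, ht]
  have hskew (u v) : gP ↥W (A' u) v = - gP ↥W u (A' v) := by
    have h₁ := hA' u
    have h₂ := hA' v
    simp only [LinearMap.comp_apply] at h₁ h₂
    rw [hg, hg, h₁, h₂, hA]
  refine ⟨A', hskew, fun u => ?_, fun μ => pullback_eigSp ht hA hskew hA' μ⟩
  have hsq : A' ∘ₗ A' = c • LinearMap.id := by
    refine LinearMap.ext fun w => hinj ?_
    change (bigIncl V W ∘ₗ t) (A' (A' w)) = _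
    rw [hA', hA', hc, LinearMap.smul_apply, LinearMap.id_apply, map_smul]
  rw [baseChange_comp_apply, hsq, LinearMap.baseChange_smul, LinearMap.baseChange_id]
  exact (algebraMap_smul ℂ c u).symm

/-- If `γ₀` is nondegenerate on `W`, then `{(x, ψ x + γ₀ y) : x, y ∈ W}` is the image of a section of
the restriction `W ⊕ V* → W ⊕ W*`. -/
theorem exists_section_of_nondegenerate [FiniteDimensional ℝ V] {γ₀ : LinearMap.BilinForm ℝ V}
    (ψ : LinearMap.BilinForm ℝ V) (hW : ∀ x : ↥W, (∀ y : ↥W, resB V W γ₀ x y = 0) → x = 0) :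
    ∃ t : Big ↥W →ₗ[ℝ] (↥W × Module.Dual ℝ V), (∀ w, bigRes V W (t w) = w) ∧
      (∀ w, ∃ x ∈ W, ∃ y ∈ W, bigIncl V W (t w) = (x, ψ x + γ₀ y)) ∧
      ∀ x ∈ W, ∀ y ∈ W, ∃ w, bigIncl V W (t w) = (x, ψ x + γ₀ y) := by
  have hinj : Function.Injective (resB V W γ₀) :=
    (injective_iff_map_eq_zero _).2 fun x hx => hW x fun y => by rw [hx]; rfl
  let e : ↥W ≃ₗ[ℝ] Module.Dual ℝ ↥W :=
    LinearMap.linearEquivOfInjective (resB V W γ₀) hinj Subspace.dual_finrank_eq.symm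
  have he (y : ↥W) : e y = resB V W γ₀ y := rfl
  let r : Big ↥W →ₗ[ℝ] ↥W :=
    e.symm.toLinearMap ∘ₗ (LinearMap.snd ℝ _ _ - resB V W ψ ∘ₗ LinearMap.fst ℝ _ _)
  have hr (w : Big ↥W) : r w = e.symm (w.2 - resB V W ψ w.1) := rfl
  let t : Big ↥W →ₗ[ℝ] (↥W × Module.Dual ℝ V) := LinearMap.prod (LinearMap.fst ℝ _ _)
    (ψ ∘ₗ W.subtype ∘ₗ LinearMap.fst ℝ _ _ + γ₀ ∘ₗ W.subtype ∘ₗ r)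
  refine ⟨t, fun w => Prod.ext rfl ?_, fun w => ⟨w.1, w.1.2, r w, (r w).2, rfl⟩,
    fun x hx y hy => ⟨(⟨x, hx⟩, resB V W ψ ⟨x, hx⟩ + resB V W γ₀ ⟨y, hy⟩), ?_⟩⟩
  · change resB V W ψ w.1 + resB V W γ₀ (r w) = w.2
    rw [← he, hr, e.apply_symm_apply, add_sub_cancel]
  · change (x, ψ x + γ₀ (r _ : V)) = _
    rw [hr, add_sub_cancel_left, ← he, e.symm_apply_apply]

end InducedStructure

section AdaptedFrame

variable {V : Type} [AddCommGroup V] [Module ℝ V]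

theorem Hsp_apply_of_graph {H : Big V →ₗ[ℝ] Big V} {γ₀ ψ : LinearMap.BilinForm ℝ V}
    (hgraph : (Hsp V H : Set (Bc V)) = graphSet V γ₀ ψ) (x : V) :
    (1 : ℂ) ⊗ₜ[ℝ] ((x, ψ x) : Big V) + Complex.I ⊗ₜ[ℝ] ((0, γ₀ x) : Big V) ∈ Hsp V H := by
  rw [← SetLike.mem_coe, hgraph]
  intro Y
  induction Y using TensorProduct.induction_on with
  | zero => simp
  | add Y₁ Y₂ h₁ h₂ =>
    simp only [map_add, mul_add] at h₁ h₂ ⊢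
    linear_combination h₁ + h₂
  | tmul z y =>
    simp only [map_add, LinearMap.add_apply, inV, prV, LinearMap.baseChange_tmul, gc_tmul, bcB_tmul,
      gP_apply]
    simp
    ring

theorem apply_adapted_of_graph {H : Big V →ₗ[ℝ] Big V} {γ₀ ψ : LinearMap.BilinForm ℝ V}
    (hgraph : (Hsp V H : Set (Bc V)) = graphSet V γ₀ ψ) (x y : V) :
    H (x, ψ x + γ₀ y) = (y, ψ y + γ₀ (-x)) := by
  have key (x : V) : H (x, ψ x) = -(0, γ₀ x) ∧ H (0, γ₀ x) = (x, ψ x) := by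
    have h := mem_eigSp.1 (Hsp_apply_of_graph hgraph x)
    rw [map_add, LinearMap.baseChange_tmul, LinearMap.baseChange_tmul, smul_add,
      TensorProduct.smul_tmul', TensorProduct.smul_tmul', smul_eq_mul, smul_eq_mul, mul_one,
      Complex.I_mul_I, TensorProduct.neg_tmul, ← TensorProduct.tmul_neg, add_comm (Complex.I ⊗ₜ _)]
      at h
    exact one_tmul_add_I_tmul_inj h
  rw [show ((x, ψ x + γ₀ y) : Big V) = (x, ψ x) + (0, γ₀ y) by simp, map_add, (key x).1, (key y).2]
  simp [add_comm]

theorem one_tmul_add_I_tmul_mem_range {W : Submodule ℝ V} {a b : V} :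
    (1 : ℂ) ⊗ₜ[ℝ] a + Complex.I ⊗ₜ[ℝ] b ∈ LinearMap.range (LinearMap.baseChange ℂ W.subtype) ↔
      a ∈ W ∧ b ∈ W := by
  constructor
  · rintro ⟨w, hw⟩
    obtain ⟨c, d, rfl⟩ := exists_one_tmul_add_I_tmul w
    rw [map_add, LinearMap.baseChange_tmul, LinearMap.baseChange_tmul] at hw
    obtain ⟨rfl, rfl⟩ := one_tmul_add_I_tmul_inj hw
    exact ⟨c.2, d.2⟩
  · rintro ⟨ha, hb⟩
    exact ⟨(1 : ℂ) ⊗ₜ[ℝ] (⟨a, ha⟩ : ↥W) + Complex.I ⊗ₜ[ℝ] (⟨b, hb⟩ : ↥W), by simp⟩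

/-- Invariance of `W^ℂ` under `F`, in terms of the real and imaginary parts of `F`. -/
theorem invariant_iff {A H : Big V →ₗ[ℝ] Big V} {γ₀ ψ : LinearMap.BilinForm ℝ V}
    {F : Vc V →ₗ[ℂ] Vc V} (hgraph : (Hsp V H : Set (Bc V)) = graphSet V γ₀ ψ)
    (hF : ∀ u ∈ Hsp V H, prV V (LinearMap.baseChange ℂ A u) = F (prV V u)) (W : Submodule ℝ V) :
    (∀ w : Vc ↥W, F (LinearMap.baseChange ℂ W.subtype w) ∈
        LinearMap.range (LinearMap.baseChange ℂ W.subtype)) ↔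
      ∀ x ∈ W, (A (x, ψ x)).1 ∈ W ∧ (A (0, γ₀ x)).1 ∈ W := by
  have hFx (x : V) : F ((1 : ℂ) ⊗ₜ[ℝ] x) =
      (1 : ℂ) ⊗ₜ[ℝ] (A (x, ψ x)).1 + Complex.I ⊗ₜ[ℝ] (A (0, γ₀ x)).1 := by
    simpa [prV] using (hF _ (Hsp_apply_of_graph hgraph x)).symm
  constructor
  · intro h x hx
    rw [← one_tmul_add_I_tmul_mem_range, ← hFx]
    exact h ((1 : ℂ) ⊗ₜ[ℝ] (⟨x, hx⟩ : ↥W))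
  · intro h w
    induction w using TensorProduct.induction_on with
    | zero => simp
    | add w₁ w₂ h₁ h₂ => rw [map_add, map_add]; exact add_mem h₁ h₂
    | tmul z x =>
      have : z ⊗ₜ[ℝ] x = z • ((1 : ℂ) ⊗ₜ[ℝ] x) := by simp [TensorProduct.smul_tmul']
      rw [this, map_smul, map_smul, LinearMap.baseChange_tmul, hFx]
      exact Submodule.smul_mem _ _ (one_tmul_add_I_tmul_mem_range.2 (h _ x.2))

theorem exists_adapted [FiniteDimensional ℝ V] {γ₀ : LinearMap.BilinForm ℝ V}
    (ψ : LinearMap.BilinForm ℝ V) (hnd : ∀ x, (∀ y, γ₀ x y = 0) → x = 0) (u : Big V) :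
    ∃ y, u = (u.1, ψ u.1 + γ₀ y) := by
  have hinj : Function.Injective γ₀ :=
    (injective_iff_map_eq_zero _).2 fun x hx => hnd x fun y => by rw [hx]; rfl
  obtain ⟨y, hy⟩ := (LinearMap.injective_iff_surjective_of_finrank_eq_finrank
    (Subspace.dual_finrank_eq (K := ℝ) (V := V)).symm).1 hinj (u.2 - ψ u.1)
  exact ⟨y, Prod.ext rfl (by rw [hy, add_sub_cancel])⟩

end AdaptedFrame

/-- pointwise content of Proposition 4.2. Let `(𝓕, 𝓙)` be a
generalized almost para-Hermitian structure on `V` with `𝓗 = 𝓙∘𝓕` and associated triple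
`(γ₀, ψ, F)`, let `W ⊆ V` be a subspace and `B = W ⊕ V*`. Then `W` is regular invariant
(`γ₀|_W` nondegenerate and `F(W^ℂ) ⊆ W^ℂ`) iff (i) `𝓕` induces a generalized almost
para-complex structure and `𝓙` induces a generalized almost complex structure on
`W ⊕ W*` via pullback of eigenspaces, and (ii) `B = (B ∩ 𝓕B ∩ 𝓙B ∩ 𝓗B) + ann W`. -/
theorem regular_invariant_iff (V : Type) [AddCommGroup V] [Module ℝ V]
    [FiniteDimensional ℝ V]
    (𝓕 𝓙 : Big V →ₗ[ℝ] Big V) (h : IsGAPH V 𝓕 𝓙)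
    (γ₀ ψ : LinearMap.BilinForm ℝ V)
    (hsym : ∀ x y, γ₀ x y = γ₀ y x) (hnd : ∀ x, (∀ y, γ₀ x y = 0) → x = 0)
    (hanti : ∀ x y, ψ x y = - ψ y x)
    (F : Vc V →ₗ[ℂ] Vc V)
    (hgraph : (Hsp V (𝓙 ∘ₗ 𝓕) : Set (Bc V)) = graphSet V γ₀ ψ)
    (hFchar : ∀ u ∈ Hsp V (𝓙 ∘ₗ 𝓕), prV V (LinearMap.baseChange ℂ 𝓕 u) = F (prV V u))
    (W : Submodule ℝ V) :
    ((∀ x : ↥W, (∀ y : ↥W, resB V W γ₀ x y = 0) → x = 0) ∧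
     (∀ w : Vc ↥W, F (LinearMap.baseChange ℂ W.subtype w) ∈
        LinearMap.range (LinearMap.baseChange ℂ W.subtype))) ↔
    ((IsCompl (pullback V W (Fplus V 𝓕)) (pullback V W (Fminus V 𝓕)) ∧
      MaxIsotropic ↥W (pullback V W (Fplus V 𝓕)) ∧
      MaxIsotropic ↥W (pullback V W (Fminus V 𝓕)) ∧
      conjSub ↥W (pullback V W (Fplus V 𝓕)) = pullback V W (Fplus V 𝓕) ∧
      conjSub ↥W (pullback V W (Fminus V 𝓕)) = pullback V W (Fminus V 𝓕) ∧
      IsCompl (pullback V W (Hsp V 𝓙)) (pullback V W (conjSub V (Hsp V 𝓙))) ∧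
      MaxIsotropic ↥W (pullback V W (Hsp V 𝓙))) ∧
     (W.prod (⊤ : Submodule ℝ (Module.Dual ℝ V)) =
       (W.prod (⊤ : Submodule ℝ (Module.Dual ℝ V)) ⊓
        Submodule.map 𝓕 (W.prod (⊤ : Submodule ℝ (Module.Dual ℝ V))) ⊓
        Submodule.map 𝓙 (W.prod (⊤ : Submodule ℝ (Module.Dual ℝ V))) ⊓
        Submodule.map (𝓙 ∘ₗ 𝓕) (W.prod (⊤ : Submodule ℝ (Module.Dual ℝ V)))) ⊔
       (⊥ : Submodule ℝ V).prod W.dualAnnihilator)) := by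
  obtain ⟨⟨hFF, hFskew⟩, ⟨hJJ, hJskew⟩, hcomm, -⟩ := h
  have hFF' (u) : 𝓕 (𝓕 u) = u := LinearMap.congr_fun hFF u
  have hJJ' (u) : 𝓙 (𝓙 u) = -u := LinearMap.congr_fun hJJ u
  have hcomm' (u) : 𝓕 (𝓙 u) = 𝓙 (𝓕 u) := LinearMap.congr_fun hcomm u
  have hH (x y : V) : 𝓙 (𝓕 (x, ψ x + γ₀ y)) = (y, ψ y + γ₀ (-x)) :=
    apply_adapted_of_graph hgraph x y
  rw [invariant_iff hgraph hFchar W]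
  constructor
  · rintro ⟨hW, hinv⟩
    have hfst (x y : V) (hx : x ∈ W) (hy : y ∈ W) : (𝓕 (x, ψ x + γ₀ y)).1 ∈ W := by
      rw [show ((x, ψ x + γ₀ y) : Big V) = (x, ψ x) + (0, γ₀ y) by simp, map_add]
      exact add_mem (hinv x hx).1 (hinv y hy).2
    have hFstab (x y : V) (hx : x ∈ W) (hy : y ∈ W) :
        ∃ x' ∈ W, ∃ y' ∈ W, 𝓕 (x, ψ x + γ₀ y) = (x', ψ x' + γ₀ y') := by
      obtain ⟨y', hy'⟩ := exists_adapted ψ hnd (𝓕 (x, ψ x + γ₀ y))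
      refine ⟨_, hfst x y hx hy, y', ?_, hy'⟩
      have h₁ := hH (𝓕 (x, ψ x + γ₀ y)).1 y'
      rw [← hy', ← hcomm', hH] at h₁
      have h₂ := hfst y (-x) hy (neg_mem hx)
      rwa [h₁] at h₂
    have hJstab (x y : V) (hx : x ∈ W) (hy : y ∈ W) :
        ∃ x' ∈ W, ∃ y' ∈ W, 𝓙 (x, ψ x + γ₀ y) = (x', ψ x' + γ₀ y') := by
      obtain ⟨x', hx', y', hy', h'⟩ := hFstab x y hx hy
      refine ⟨y', hy', -x', neg_mem hx', ?_⟩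
      rw [← hH, ← h', hFF']
    obtain ⟨t, ht, ht₁, ht₂⟩ := exists_section_of_nondegenerate ψ hW
    obtain ⟨F', hF'skew, hF'sq, hF'⟩ := exists_pullback_eigSp ht hFskew (c := 1)
      (fun u => by rw [hFF', one_smul])
      fun w => by
        obtain ⟨x, hx, y, hy, h⟩ := ht₁ w
        obtain ⟨x', hx', y', hy', h'⟩ := hFstab x y hx hy
        rw [h, h']
        exact ht₂ x' hx' y' hy'
    obtain ⟨J', hJ'skew, hJ'sq, hJ'⟩ := exists_pullback_eigSp ht hJskew (c := -1)
      (fun u => (hJJ' u).trans (neg_one_smul ℝ u).symm)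
      fun w => by
        obtain ⟨x, hx, y, hy, h⟩ := ht₁ w
        obtain ⟨x', hx', y', hy', h'⟩ := hJstab x y hx hy
        rw [h, h']
        exact ht₂ x' hx' y' hy'
    have hJ'sq (u) : LinearMap.baseChange ℂ J' (LinearMap.baseChange ℂ J' u) =
        (Complex.I * Complex.I) • u := by simpa using hJ'sq u
    constructor
    · rw [Hsp, Fplus, Fminus, conjSub_eigSp, hF', hF', hJ', hJ', conjSub_eigSp, conjSub_eigSp,
        Complex.conj_I]
      exact ⟨isCompl_eigSp one_ne_zero (by simpa using hF'sq),
        maxIsotropic_eigSp hF'skew one_ne_zero (by simpa using hF'sq),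
        maxIsotropic_eigSp hF'skew (neg_ne_zero.2 one_ne_zero) (by simpa using hF'sq),
        by simp, by simp, isCompl_eigSp Complex.I_ne_zero hJ'sq,
        maxIsotropic_eigSp hJ'skew Complex.I_ne_zero hJ'sq⟩
    · apply le_antisymm
      · rintro ⟨x, α⟩ ⟨hx, -⟩
        obtain ⟨x', hx', y, hy, h⟩ := ht₁ (⟨x, hx⟩, W.subtype.dualMap α)
        have hres := ht (⟨x, hx⟩, W.subtype.dualMap α)
        obtain rfl : x = x' :=
          (congrArg (fun w : Big ↥W => (w.1 : V)) hres).symm.trans (congrArg Prod.fst h)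
        refine Submodule.mem_sup.2 ⟨(x, ψ x + γ₀ y), ⟨⟨⟨⟨hx, trivial⟩, ?_⟩, ?_⟩, ?_⟩,
          (0, α - (ψ x + γ₀ y)), ⟨rfl, ?_⟩, by simp⟩
        · exact ⟨_, ⟨hfst x y hx hy, trivial⟩, hFF' _⟩
        · obtain ⟨x', hx', y', hy', h'⟩ := hJstab x y hx hy
          refine ⟨-(x', ψ x' + γ₀ y'), ⟨neg_mem hx', trivial⟩, ?_⟩
          rw [← h', map_neg, hJJ', neg_neg]
        · refine ⟨(-y, ψ (-y) + γ₀ x), ⟨neg_mem hy, trivial⟩, ?_⟩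
          rw [LinearMap.comp_apply, hH, neg_neg]
        · rw [SetLike.mem_coe, Submodule.mem_dualAnnihilator]
          intro w hw
          have h₁ := LinearMap.congr_fun (congrArg Prod.snd hres) ⟨w, hw⟩
          have h₂ := LinearMap.congr_fun (congrArg Prod.snd h) w
          have h₃ : (ψ x + γ₀ y) w = α w := h₂.symm.trans h₁
          rw [LinearMap.sub_apply, h₃, sub_self]
      · refine sup_le (inf_le_left.trans (inf_le_left.trans inf_le_left)) ?_
        rintro ⟨x, α⟩ ⟨hx, -⟩
        obtain rfl : x = 0 := hx
        exact ⟨W.zero_mem, trivial⟩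
  · rintro ⟨-, hB⟩
    -- elements of `B ∩ 𝓗 B` have both adapted components in `W`
    have hdecomp (u : Big V) (hu : u.1 ∈ W) : ∃ s : Big V, ∃ z ∈ W, s = (u.1, ψ u.1 + γ₀ z) ∧
        (𝓕 s).1 ∈ W ∧ ∃ β ∈ W.dualAnnihilator, u.2 = s.2 + β := by
      have hu' : u ∈ W.prod (⊤ : Submodule ℝ (Module.Dual ℝ V)) := ⟨hu, trivial⟩
      rw [hB] at hu'
      obtain ⟨s, ⟨⟨⟨-, b, hb, hbs⟩, -⟩, c, hc, hcs⟩, a, ⟨ha, haβ⟩, rfl⟩ := Submodule.mem_sup.1 hu'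
      have ha : a.1 = 0 := ha
      obtain ⟨z, hz⟩ := exists_adapted ψ hnd s
      refine ⟨s, z, ?_, ?_, ?_, a.2, haβ, rfl⟩
      · obtain ⟨y, hy⟩ := exists_adapted ψ hnd c
        rw [LinearMap.comp_apply, hy, hH, hz] at hcs
        obtain ⟨h₁, h₂⟩ := Prod.ext_iff.1 hcs
        dsimp only at h₁ h₂
        rw [h₁, add_right_inj] at h₂
        have h₃ : -c.1 = z := sub_eq_zero.1 <| hnd _ fun y => by
          rw [map_sub, h₂, sub_self, LinearMap.zero_apply]
        exact h₃ ▸ neg_mem hc.1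
      · simpa [ha] using hz
      · rw [← hbs, hFF']
        exact hb.1
    have hW (x : V) (hx : x ∈ W) (hxW : ∀ y ∈ W, γ₀ x y = 0) : x = 0 := by
      refine hnd x fun y => ?_
      obtain ⟨s, z, hz, hs, -, β, hβ, h⟩ := hdecomp (0, γ₀ y) W.zero_mem
      have := LinearMap.congr_fun h x
      rw [hs] at this
      simp only [map_zero, zero_add, LinearMap.add_apply,
        (Submodule.mem_dualAnnihilator β).1 hβ x hx, add_zero] at this
      rw [hsym, this, hsym, hxW z hz]
    have hF (x y : V) (hx : x ∈ W) (hy : y ∈ W) : (𝓕 (x, ψ x + γ₀ y)).1 ∈ W := by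
      obtain ⟨s, z, hz, hs, hFs, β, hβ, h⟩ := hdecomp (x, ψ x + γ₀ y) hx
      have : y = z := sub_eq_zero.1 <| hW _ (sub_mem hy hz) fun w hw => by
        have := LinearMap.congr_fun h w
        rw [hs] at this
        simp only [LinearMap.add_apply, (Submodule.mem_dualAnnihilator β).1 hβ w hw] at this
        rw [map_sub, LinearMap.sub_apply]
        linarith
      rw [this]
      exact hs ▸ hFs
    refine ⟨fun x hx => Subtype.ext (hW x x.2 fun y hy => hx ⟨y, hy⟩), fun x hx => ⟨?_, ?_⟩⟩
    · simpa using hF x 0 hx W.zero_mem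
    · simpa using hF 0 x W.zero_mem hx
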